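/- Let n ≥ 2 and let G₁,…,G_n be nontrivial finitely generated groups with finite generating sets S₁,…,S_n. Then p_exp of the Cayley graph of the free product G₁*…*G_n with respect to S₁ ⊔ … ⊔ S_n equals min_{1≤i≤n} p_exp(Gᵢ), where p_exp(Gᵢ) is taken for the Cayley graph of (Gᵢ,Sᵢ) (note that p_exp(Gᵢ) = 1 automatically when Gᵢ is finite). -/

import Mathlib

open MeasureTheory ENNReal

namespace Perc

/-- Percolation configurations on the edge set `E`: each edge is `true` (open) or
`false` (closed). -/
abbrev Config (E : Type*) := E → Bool

/-- `μ` is the Bernoulli product measure `P_p` with parameter `p` on `{0,1}^E`: the measure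
of every finite cylinder event is the corresponding product.  (This determines `μ` uniquely
on the product σ-algebra, since cylinders form a π-system generating it.) -/
def IsBernoulli {E : Type*} (p : ℝ) (μ : Measure (Config E)) : Prop :=
  ∀ (F : Finset E) (σ : E → Bool),
    μ {ω | ∀ e ∈ F, ω e = σ e} =
      ∏ e ∈ F, ENNReal.ofReal (if σ e then p else 1 - p)

variable {G ι : Type*} [Group G]

/-- In the Cayley graph of `G` with edge set `G × ι`, where the edge `(a, i)` joins `a` and
`a * f i` (the function `f : ι → G` lists the generators, with multiplicity), this says that
vertices `a` and `b` are joined by some open edge of the configuration `ω`. -/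
def Step (f : ι → G) (ω : Config (G × ι)) (a b : G) : Prop :=
  ∃ i : ι, (ω (a, i) = true ∧ b = a * f i) ∨ (ω (b, i) = true ∧ a = b * f i)

/-- `x` and `y` are connected by a path of open edges (`x ↔ y`). -/
def Conn (f : ι → G) (ω : Config (G × ι)) (x y : G) : Prop :=
  Relation.ReflTransGen (Step f ω) x y

/-- The open cluster `C` of the identity. -/
def cluster (f : ι → G) (ω : Config (G × ι)) : Set G :=
  {x | Conn f ω 1 x}

/-- The percolation function `θ`: the probability that the cluster of the identity is
infinite. -/
noncomputable def theta (f : ι → G) (μ : Measure (Config (G × ι))) : ℝ :=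
  (μ {ω | (cluster f ω).Infinite}).toReal

/-- The expected cluster size `χ = E(|C|) ∈ [0,∞]` (where `|C| ∈ ℕ∞` is coerced
to `ℝ≥0∞`). -/
noncomputable def chi (f : ι → G) (μ : Measure (Config (G × ι))) : ℝ≥0∞ :=
  ∫⁻ ω, ((cluster f ω).encard : ℝ≥0∞) ∂μ

/-- The critical probability `p_c = inf {p ∈ [0,1] | θ(p) > 0}`, with the convention
`p_c = 1` if `θ` vanishes on `[0,1]`; here `μ p` is the percolation measure at
parameter `p`. -/
noncomputable def pc (f : ι → G) (μ : ℝ → Measure (Config (G × ι))) : ℝ :=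
  sInf ({p | p ∈ Set.Icc (0 : ℝ) 1 ∧ 0 < theta f (μ p)} ∪ {1})

/-- The word metric on `G` with respect to the generators `f i`: the length of a shortest
word in the generators and their inverses taking `x` to `y`.  (When the generators generate
`G`, this is the graph distance in the Cayley graph.) -/
noncomputable def wdist (f : ι → G) (x y : G) : ℕ :=
  sInf {n : ℕ | ∃ l : List G, l.length = n ∧
    (∀ g ∈ l, (∃ i, f i = g) ∨ (∃ i, (f i)⁻¹ = g)) ∧ x * l.prod = y}

/-- Schonmann's critical point
`p_exp = sup {p ∈ [0,1] | ∃ c > 0, γ > 0, ∀ x y, P_p(x ↔ y) ≤ c·exp(-γ·dist(x,y))}`. -/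
noncomputable def pexp (f : ι → G) (μ : ℝ → Measure (Config (G × ι))) : ℝ :=
  sSup {p | p ∈ Set.Icc (0 : ℝ) 1 ∧ ∃ c > 0, ∃ γ > 0, ∀ x y : G,
    (μ p {ω | Conn f ω x y}).toReal ≤ c * Real.exp (-γ * (wdist f x y : ℝ))}

/-- The walk-through function `g(p,t) = 1 - ∑_{n≥1} (1-t)^{n-1} P_p(|C| = n)` of a Cayley
graph; here `μ` is the percolation measure at parameter `p`. -/
noncomputable def wt (f : ι → G) (μ : Measure (Config (G × ι))) (t : ℝ) : ℝ :=
  1 - ∑' n : ℕ, (1 - t) ^ n * (μ {ω | (cluster f ω).encard = ((n + 1 : ℕ) : ℕ∞)}).toReal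

/-- The ball of radius `j`: all products of at most `j` elements of `S ∪ S⁻¹`. -/
def ball (S : Set G) (j : ℕ) : Set G :=
  {g | ∃ l : List G, l.length ≤ j ∧ (∀ x ∈ l, x ∈ S ∨ x⁻¹ ∈ S) ∧ l.prod = g}

/-- The Cheeger constant `h = inf_K |∂K| / |K|`, the infimum over nonempty finite vertex
sets `K` of the number of edges `(a, i)` (joining `a` and `a * f i`) with exactly one
endpoint in `K`, divided by `|K|`. -/
noncomputable def cheeger (f : ι → G) : ℝ :=
  ⨅ K : {K : Finset G // K.Nonempty},
    (Nat.card {e : G × ι // Xor' (e.1 ∈ K.1) (e.1 * f e.2 ∈ K.1)} : ℝ) / (K.1.card : ℝ)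

/-- The open cluster of the identity in the subgraph induced on the vertex set `V`: only
open edges with both endpoints in `V` may be used. -/
def clusterIn (f : ι → G) (V : Set G) (ω : Config (G × ι)) : Set G :=
  {x | Relation.ReflTransGen (fun a b => Step f ω a b ∧ a ∈ V ∧ b ∈ V) 1 x}

/-- The generators of `G` given by a generating set `S` (one edge orbit per element
of `S`). -/
def setGens (S : Set G) : S → G := Subtype.val

/-- The generators of the free product `G₁ * G₂` given by the disjoint union `S₁ ⊔ S₂` of
generating sets, embedded via the canonical monomorphisms. -/
def coprodGens {G₁ G₂ : Type*} [Group G₁] [Group G₂] (S₁ : Set G₁) (S₂ : Set G₂) :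
    S₁ ⊕ S₂ → Monoid.Coprod G₁ G₂ :=
  Sum.elim (fun s => Monoid.Coprod.inl (s : G₁)) (fun s => Monoid.Coprod.inr (s : G₂))

/-- The generators of the free product `G₁ * ⋯ * G_n` given by the disjoint union
`S₁ ⊔ ⋯ ⊔ S_n` of generating sets, embedded via the canonical monomorphisms. -/
def coprodIGens {n : ℕ} {G : Fin n → Type*} [∀ i, Group (G i)] (S : ∀ i, Set (G i)) :
    (Σ i, S i) → Monoid.CoprodI G :=
  fun x => Monoid.CoprodI.of (x.2 : G x.1)

/-- The image of a list of syllables in the free product `G₁ * G₂`. -/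
def sylProd {G₁ G₂ : Type*} [Group G₁] [Group G₂] (l : List (G₁ ⊕ G₂)) :
    Monoid.Coprod G₁ G₂ :=
  (l.map (Sum.elim (fun g => Monoid.Coprod.inl g) (fun h => Monoid.Coprod.inr h))).prod

/-- The set `P₁` of nontrivial elements of `G₁ * G₂` whose normal form begins with a
nontrivial syllable of `G₁`: elements represented by a nonempty alternating product of
nontrivial syllables, the first syllable lying in `G₁`.  (Such a representation is the
normal form, which is unique.) -/
def beginsLeft {G₁ G₂ : Type*} [Group G₁] [Group G₂] (x : Monoid.Coprod G₁ G₂) : Prop :=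
  ∃ l : List (G₁ ⊕ G₂), l ≠ [] ∧ (∀ a ∈ l, a ≠ Sum.inl 1 ∧ a ≠ Sum.inr 1) ∧
    l.Chain' (fun a b => a.isLeft ≠ b.isLeft) ∧
    (∃ g : G₁, l.head? = some (Sum.inl g)) ∧ sylProd l = x

/-- The set `P₂` of nontrivial elements of `G₁ * G₂` whose normal form begins with a
nontrivial syllable of `G₂`. -/
def beginsRight {G₁ G₂ : Type*} [Group G₁] [Group G₂] (x : Monoid.Coprod G₁ G₂) : Prop :=
  ∃ l : List (G₁ ⊕ G₂), l ≠ [] ∧ (∀ a ∈ l, a ≠ Sum.inl 1 ∧ a ≠ Sum.inr 1) ∧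
    l.Chain' (fun a b => a.isLeft ≠ b.isLeft) ∧
    (∃ h : G₂, l.head? = some (Sum.inr h)) ∧ sylProd l = x

end Perc

namespace Perc

/-- The Bernoulli law on `Bool` with parameter `p`, realised through a uniform variable. -/
noncomputable def bernoulliBool (p : ℝ) : Measure Bool :=
  (volume : Measure unitInterval).map fun u : unitInterval => decide ((u : ℝ) < p)

lemma measurable_decide_lt (p : ℝ) :
    Measurable fun u : unitInterval => decide ((u : ℝ) < p) := by
  refine measurable_to_bool ?_
  have : (fun u : unitInterval => decide ((u : ℝ) < p)) ⁻¹' {true} =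
      {u : unitInterval | (u : ℝ) < p} := by ext; simp
  rw [this]
  exact measurableSet_lt measurable_subtype_coe measurable_const

instance (p : ℝ) : IsProbabilityMeasure (bernoulliBool p) :=
  Measure.isProbabilityMeasure_map (measurable_decide_lt p).aemeasurable

lemma bernoulliBool_singleton {p : ℝ} (hp : p ∈ Set.Icc (0 : ℝ) 1) (b : Bool) :
    bernoulliBool p {b} = ENNReal.ofReal (if b then p else 1 - p) := by
  have htrue : bernoulliBool p {true} = ENNReal.ofReal p := by
    rw [bernoulliBool, Measure.map_apply (measurable_decide_lt p) (measurableSet_singleton _)]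
    have : (fun u : unitInterval => decide ((u : ℝ) < p)) ⁻¹' {true} = Set.Iio ⟨p, hp⟩ := by
      ext u; simp [← Subtype.coe_lt_coe]
    rw [this, unitInterval.volume_Iio]
  cases b with
  | true => simpa using htrue
  | false =>
    have : ({false} : Set Bool) = {true}ᶜ := by ext b; simp
    rw [this, prob_compl_eq_one_sub (measurableSet_singleton _), htrue]
    simp [ENNReal.ofReal_sub _ hp.1]

/-- A Bernoulli percolation measure is the product of Bernoulli laws. -/
lemma IsBernoulli.eq_infinitePi {E : Type*} {p : ℝ} (hp : p ∈ Set.Icc (0 : ℝ) 1)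
    {μ : Measure (Config E)} (h : IsBernoulli p μ) :
    μ = Measure.infinitePi fun _ : E => bernoulliBool p := by
  classical
  refine IsProjectiveLimit.unique (fun I => ?_) (Measure.isProjectiveLimit_infinitePi _)
  refine Measure.ext_of_singleton fun σ => ?_
  rw [Measure.pi_singleton, Measure.map_apply (by fun_prop) (measurableSet_singleton _)]
  have hσ := h I fun e => if he : e ∈ I then σ ⟨e, he⟩ else true
  have hset : I.restrict ⁻¹' ({σ} : Set (I → Bool)) =
      {ω : Config E | ∀ e ∈ I, ω e = if he : e ∈ I then σ ⟨e, he⟩ else true} := by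
    ext ω
    simp only [Set.mem_preimage, Set.mem_singleton_iff, funext_iff, Subtype.forall,
      Finset.restrict, Set.mem_ofPred_eq]
    refine forall₂_congr fun e he => ?_
    rw [dif_pos he]
  rw [hset, hσ, ← Finset.prod_coe_sort]
  refine Finset.prod_congr rfl fun e _ => ?_
  rw [bernoulliBool_singleton hp, dif_pos e.2]

lemma IsBernoulli.isProbabilityMeasure {E : Type*} {p : ℝ} {μ : Measure (Config E)}
    (h : IsBernoulli p μ) : IsProbabilityMeasure μ :=
  ⟨by simpa using h ∅ fun _ => true⟩

/-- Restricting a Bernoulli measure along an injection of edge sets gives a Bernoulli measure. -/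
lemma IsBernoulli.map_comp {E E' : Type*} {p : ℝ} (hp : p ∈ Set.Icc (0 : ℝ) 1)
    {μ : Measure (Config E)} {μ' : Measure (Config E')} (h : IsBernoulli p μ)
    (h' : IsBernoulli p μ') {e : E' → E} (he : Function.Injective e) :
    μ.map (fun ω i => ω (e i)) = μ' := by
  rw [h.eq_infinitePi hp, h'.eq_infinitePi hp]
  exact Measure.map_infinitePi_infinitePi_of_inj he

/-- Monotone coupling: increasing events have nondecreasing probability in `p`. -/
lemma IsBernoulli.measure_mono {E : Type*} {p q : ℝ} (hp : p ∈ Set.Icc (0 : ℝ) 1)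
    (hq : q ∈ Set.Icc (0 : ℝ) 1) (hpq : p ≤ q) {μ ν : Measure (Config E)}
    (hμ : IsBernoulli p μ) (hν : IsBernoulli q ν) {A : Set (Config E)} (hA : MeasurableSet A)
    (hup : ∀ ω ω' : Config E, (∀ e, ω e = true → ω' e = true) → ω ∈ A → ω' ∈ A) :
    μ A ≤ ν A := by
  have key : ∀ r : ℝ, Measurable fun (x : E → unitInterval) e => decide ((x e : ℝ) < r) :=
    fun r => measurable_pi_lambda _ fun e => (measurable_decide_lt r).comp (measurable_pi_apply e)
  rw [hμ.eq_infinitePi hp, hν.eq_infinitePi hq]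
  unfold bernoulliBool
  rw [← Measure.infinitePi_map_pi _ fun _ => measurable_decide_lt p,
    ← Measure.infinitePi_map_pi _ fun _ => measurable_decide_lt q,
    Measure.map_apply (key p) hA, Measure.map_apply (key q) hA]
  refine MeasureTheory.measure_mono fun x hx => hup _ _ (fun e he => ?_) hx
  simp only [decide_eq_true_eq] at he ⊢
  exact he.trans_le hpq

/-- The σ-algebra of events depending only on the edges in `T`. -/
abbrev edgeSigma {E : Type*} (T : Set E) : MeasurableSpace (Config E) :=
  ⨆ e ∈ T, MeasurableSpace.comap (fun ω : Config E => ω e) inferInstance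

lemma edgeSigma_mono {E : Type*} {T T' : Set E} (h : T ⊆ T') : edgeSigma T ≤ edgeSigma T' :=
  biSup_mono h

lemma measurableSet_edgeSigma_preimage {E E' : Type*} (e : E' → E) {T : Set E}
    (hT : ∀ i, e i ∈ T) {A : Set (Config E')} (hA : MeasurableSet A) :
    MeasurableSet[edgeSigma T] ((fun (ω : Config E) i => ω (e i)) ⁻¹' A) := by
  have : Measurable[edgeSigma T] fun (ω : Config E) i => ω (e i) := by
    refine @measurable_pi_lambda _ _ _ (edgeSigma T) _ _ fun i => ?_
    refine Measurable.mono (comap_measurable fun ω : Config E => ω (e i)) ?_ le_rfl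
    exact le_iSup₂_of_le (e i) (hT i) le_rfl
  exact this hA

lemma IsBernoulli.measure_inter {E : Type*} {p : ℝ} (hp : p ∈ Set.Icc (0 : ℝ) 1)
    {μ : Measure (Config E)} (h : IsBernoulli p μ) {T T' : Set E} (hT : Disjoint T T')
    {A B : Set (Config E)} (hA : MeasurableSet[edgeSigma T] A)
    (hB : MeasurableSet[edgeSigma T'] B) : μ (A ∩ B) = μ A * μ B := by
  have hind : ProbabilityTheory.iIndepFun (fun (e : E) (ω : Config E) => ω e) μ := by
    rw [h.eq_infinitePi hp]
    exact ProbabilityTheory.iIndepFun_infinitePi (X := fun _ b => b) fun _ => measurable_id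
  have := ProbabilityTheory.indep_iSup_of_disjoint
    (fun e => (measurable_pi_apply e).comap_le) hind.iIndep hT
  exact (ProbabilityTheory.Indep_iff _ _ μ).1 this A B hA hB

end Perc

namespace Perc

section Cayley

variable {G ι : Type*} [Group G]

lemma Conn.mono {f : ι → G} {ω ω' : Config (G × ι)} (h : ∀ e, ω e = true → ω' e = true)
    {x y : G} (hxy : Conn f ω x y) : Conn f ω' x y :=
  Relation.ReflTransGen.mono
    (fun _ _ ⟨i, hi⟩ => ⟨i, hi.imp (fun h' => ⟨h _ h'.1, h'.2⟩) fun h' => ⟨h _ h'.1, h'.2⟩⟩) _ _ hxy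

lemma measurableSet_step [Countable ι] (f : ι → G) (x y : G) :
    MeasurableSet {ω : Config (G × ι) | Step f ω x y} := by
  have hopen : ∀ e : G × ι, MeasurableSet {ω : Config (G × ι) | ω e = true} := fun e =>
    measurableSet_eq_fun (measurable_pi_apply e) measurable_const
  have : {ω : Config (G × ι) | Step f ω x y} = ⋃ i : ι,
      ({ω | ω (x, i) = true} ∩ {_ω | y = x * f i}) ∪
        ({ω | ω (y, i) = true} ∩ {_ω | x = y * f i}) := by
    ext ω; simp [Step]
  rw [this]
  exact MeasurableSet.iUnion fun i =>
    ((hopen _).inter (MeasurableSet.const _)).union ((hopen _).inter (MeasurableSet.const _))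

lemma measurableSet_conn [Countable G] [Countable ι] (f : ι → G) (x y : G) :
    MeasurableSet {ω : Config (G × ι) | Conn f ω x y} := by
  let A : ℕ → G → Set (Config (G × ι)) := fun n =>
    n.rec (fun z => {_ω | x = z}) fun _ B z => ⋃ w, B w ∩ {ω | Step f ω w z}
  have hA : ∀ n z, MeasurableSet (A n z) := by
    intro n
    induction n with
    | zero => exact fun z => MeasurableSet.const _
    | succ n ih => exact fun z => MeasurableSet.iUnion fun w => (ih w).inter (measurableSet_step f w z)
  have : {ω : Config (G × ι) | Conn f ω x y} = ⋃ n, A n y := by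
    ext ω
    simp only [Set.mem_ofPred_eq, Set.mem_iUnion]
    constructor
    · intro h
      induction h with
      | refl => exact ⟨0, rfl⟩
      | tail _ hs ih =>
        obtain ⟨n, hn⟩ := ih
        exact ⟨n + 1, Set.mem_iUnion.2 ⟨_, hn, hs⟩⟩
    · rintro ⟨n, hn⟩
      induction n generalizing y with
      | zero => obtain rfl : x = y := hn; exact .refl
      | succ n ih =>
        obtain ⟨w, hw, hs⟩ := Set.mem_iUnion.1 hn
        exact .tail (ih w hw) hs
  rw [this]
  exact MeasurableSet.iUnion fun n => hA n y

/-- The list `l` consists of generators and inverses of generators. -/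
def IsGenWord (f : ι → G) (l : List G) : Prop :=
  ∀ g ∈ l, (∃ i, f i = g) ∨ (∃ i, (f i)⁻¹ = g)

/-- Every element is a word in the generators and their inverses. -/
def Generates (f : ι → G) : Prop :=
  ∀ g : G, ∃ l, IsGenWord f l ∧ l.prod = g

lemma IsGenWord.append {f : ι → G} {l l' : List G} (h : IsGenWord f l) (h' : IsGenWord f l') :
    IsGenWord f (l ++ l') := fun g hg => (List.mem_append.1 hg).elim (h g) (h' g)

lemma generates_setGens {S : Set G} (hS : Subgroup.closure S = ⊤) : Generates (setGens S) := by
  intro g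
  have hg : g ∈ Subgroup.closure S := hS ▸ Subgroup.mem_top g
  rw [← Subgroup.mem_toSubmonoid, Subgroup.closure_toSubmonoid] at hg
  obtain ⟨l, hl, rfl⟩ := Submonoid.exists_list_of_mem_closure hg
  refine ⟨l, fun x hx => (hl x hx).imp (fun h => ⟨⟨x, h⟩, rfl⟩) fun h => ⟨⟨x⁻¹, h⟩, ?_⟩, rfl⟩
  simp [setGens]

lemma Generates.countable [Countable ι] {f : ι → G} (hf : Generates f) : Countable G := by
  refine Function.Surjective.countable (α := List (ι ⊕ ι))
    (f := fun l => (l.map (Sum.elim f fun i => (f i)⁻¹)).prod) fun g => ?_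
  obtain ⟨l, hl, rfl⟩ := hf g
  suffices ∃ a : List (ι ⊕ ι), a.map (Sum.elim f fun i => (f i)⁻¹) = l by
    obtain ⟨a, rfl⟩ := this
    exact ⟨a, rfl⟩
  induction l with
  | nil => exact ⟨[], rfl⟩
  | cons g l ih =>
    obtain ⟨a, rfl⟩ := ih fun x hx => hl x (List.mem_cons_of_mem _ hx)
    rcases hl g List.mem_cons_self with ⟨i, rfl⟩ | ⟨i, rfl⟩
    · exact ⟨Sum.inl i :: a, rfl⟩
    · exact ⟨Sum.inr i :: a, rfl⟩

lemma wdist_le {f : ι → G} {x y : G} {l : List G} (hl : IsGenWord f l) (h : x * l.prod = y) :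
    wdist f x y ≤ l.length := Nat.sInf_le ⟨l, rfl, hl, h⟩

lemma Generates.exists_word {f : ι → G} (hf : Generates f) (x y : G) :
    ∃ l, l.length = wdist f x y ∧ IsGenWord f l ∧ x * l.prod = y := by
  obtain ⟨l, hl, h⟩ := hf (x⁻¹ * y)
  exact Nat.sInf_mem (s := {n : ℕ | ∃ l : List G, l.length = n ∧
    (∀ g ∈ l, (∃ i, f i = g) ∨ (∃ i, (f i)⁻¹ = g)) ∧ x * l.prod = y})
    ⟨_, l, rfl, hl, by rw [h]; group⟩

lemma wdist_self (f : ι → G) (x : G) : wdist f x x = 0 :=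
  Nat.le_zero.1 (wdist_le (l := []) (by simp [IsGenWord]) (by simp))

lemma wdist_mul_left (f : ι → G) (z x y : G) : wdist f (z * x) (z * y) = wdist f x y := by
  simp [wdist, mul_assoc]

lemma Generates.wdist_triangle {f : ι → G} (hf : Generates f) (x y z : G) :
    wdist f x z ≤ wdist f x y + wdist f y z := by
  obtain ⟨l, hl, hw, rfl⟩ := hf.exists_word x y
  obtain ⟨l', hl', hw', rfl⟩ := hf.exists_word (x * l.prod) z
  rw [← hl, ← hl', ← List.length_append]
  exact wdist_le (hw.append hw') (by simp [mul_assoc])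

/-- A homomorphism sending generators to generators or to the identity maps words to words that
are not longer. -/
lemma IsGenWord.exists_map {G' ι' : Type*} [Group G'] {f : ι → G} {f' : ι' → G'} (φ : G →* G')
    (hφ : ∀ i, φ (f i) = 1 ∨ ∃ j, f' j = φ (f i)) {l : List G} (hl : IsGenWord f l) :
    ∃ l', IsGenWord f' l' ∧ l'.prod = φ l.prod ∧ l'.length ≤ l.length := by
  induction l with
  | nil => exact ⟨[], by simp [IsGenWord], by simp, le_rfl⟩
  | cons g l ih =>
    obtain ⟨l', hl', hp, hlen⟩ := ih fun x hx => hl x (List.mem_cons_of_mem _ hx)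
    have : φ g = 1 ∨ (∃ j, f' j = φ g) ∨ ∃ j, (f' j)⁻¹ = φ g := by
      rcases hl g List.mem_cons_self with ⟨i, rfl⟩ | ⟨i, rfl⟩
      · exact (hφ i).imp id Or.inl
      · exact (hφ i).imp (fun h => by simp [h]) fun ⟨j, hj⟩ => Or.inr ⟨j, by simp [hj]⟩
    rcases this with h | h
    · exact ⟨l', hl', by simp [h, hp], by simp; omega⟩
    · exact ⟨φ g :: l', List.forall_mem_cons.2 ⟨h, hl'⟩, by simp [hp], by simpa using hlen⟩

lemma Generates.wdist_map_le {G' ι' : Type*} [Group G'] {f : ι → G} {f' : ι' → G'}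
    (hf : Generates f) (φ : G →* G') (hφ : ∀ i, φ (f i) = 1 ∨ ∃ j, f' j = φ (f i)) (x y : G) :
    wdist f' (φ x) (φ y) ≤ wdist f x y := by
  obtain ⟨l, hl, hw, rfl⟩ := hf.exists_word x y
  obtain ⟨l', hl', hp, hlen⟩ := hw.exists_map φ hφ
  exact (wdist_le hl' (by rw [hp, map_mul])).trans (hl ▸ hlen)

/-- For `p < 1` the probability of being connected to another vertex is bounded away from `1`. -/
lemma IsBernoulli.exists_measure_conn_le [Finite ι] [Countable G] (f : ι → G) {p : ℝ}
    (hp1 : p < 1) {μ : Measure (Config (G × ι))} (h : IsBernoulli p μ) :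
    ∃ q : ℝ, 0 < q ∧ q < 1 ∧ ∀ g ≠ (1 : G), (μ {ω | Conn f ω 1 g}).toReal ≤ q := by
  classical
  have := h.isProbabilityMeasure
  have := Fintype.ofFinite ι
  let F : Finset (G × ι) := Finset.univ.image (fun i => ((1 : G), i)) ∪
    Finset.univ.image fun i => ((f i)⁻¹, i)
  have hF := h F fun _ => false
  simp only [Bool.false_eq_true, if_false, Finset.prod_const] at hF
  have hpos : 0 < (1 - p) ^ F.card := pow_pos (by linarith) _
  refine ⟨max (1 - (1 - p) ^ F.card) (1 / 2), by positivity, by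
    rw [max_lt_iff]; constructor <;> linarith, fun g hg => le_max_of_le_left ?_⟩
  have hsub : {ω : Config (G × ι) | ∀ e ∈ F, ω e = false} ⊆ {ω | Conn f ω 1 g}ᶜ := by
    intro ω hω hconn
    rcases Relation.ReflTransGen.cases_head hconn with h1 | ⟨z, ⟨i, hi⟩, -⟩
    · exact hg h1.symm
    · rcases hi with ⟨ho, -⟩ | ⟨ho, h1⟩
      · have := hω (1, i) (by simp [F])
        simp_all
      · have := hω (z, i) (by
          rw [eq_inv_of_mul_eq_one_left h1.symm]; simp [F])
        simp_all
  have hle := MeasureTheory.measure_mono (μ := μ) hsub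
  rw [hF, prob_compl_eq_one_sub (measurableSet_conn f 1 g)] at hle
  have h2 := ENNReal.toReal_mono (by simp) hle
  rw [ENNReal.toReal_sub_of_le prob_le_one (by simp), ENNReal.toReal_pow,
    ENNReal.toReal_ofReal (by linarith)] at h2
  simp at h2
  linarith

/-- Exponential decay in the sense of the definition of `pexp`. -/
def ExpDecay (f : ι → G) (μ : Measure (Config (G × ι))) : Prop :=
  ∃ c > 0, ∃ γ > 0, ∀ x y : G,
    (μ {ω | Conn f ω x y}).toReal ≤ c * Real.exp (-γ * (wdist f x y : ℝ))

/-- For `p < 1` exponential decay holds with multiplicative constant `1`. -/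
lemma ExpDecay.exists_rate [Finite ι] [Countable G] {f : ι → G} {p : ℝ}
    (hp1 : p < 1) {μ : Measure (Config (G × ι))} (h : IsBernoulli p μ) (hμ : ExpDecay f μ) :
    ∃ γ > 0, ∀ g : G, (μ {ω | Conn f ω 1 g}).toReal ≤ Real.exp (-γ * (wdist f 1 g : ℝ)) := by
  have := h.isProbabilityMeasure
  obtain ⟨c, hc, γ, hγ, hd⟩ := hμ
  obtain ⟨q, hq0, hq1, hq⟩ := h.exists_measure_conn_le f hp1
  obtain ⟨N, hN⟩ := exists_nat_gt (2 * Real.log c / γ)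
  have hlog : 0 < -Real.log q := neg_pos.2 (Real.log_neg hq0 hq1)
  have hN1 : (0 : ℝ) < N + 1 := by positivity
  refine ⟨min (γ / 2) (-Real.log q / (N + 1)), lt_min (by positivity) (by positivity), fun g => ?_⟩
  set d : ℝ := (wdist f 1 g : ℝ) with hdd
  have hd0 : 0 ≤ d := Nat.cast_nonneg _
  rcases eq_or_ne g 1 with rfl | hg
  · have : d = 0 := by rw [hdd, wdist_self]; simp
    rw [this]
    simpa using ENNReal.toReal_mono ENNReal.one_ne_top (prob_le_one (μ := μ))
  rcases le_total d N with hdN | hdN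
  · refine (hq g hg).trans ?_
    rw [← Real.log_le_iff_le_exp hq0]
    have h1 : min (γ / 2) (-Real.log q / (N + 1)) * d ≤ -Real.log q / (N + 1) * (N + 1) :=
      mul_le_mul (min_le_right _ _) (by linarith) hd0 (by positivity)
    rw [div_mul_cancel₀ _ hN1.ne'] at h1
    linarith
  · refine (hd 1 g).trans ?_
    rw [← hdd, ← Real.log_le_log_iff (by positivity) (by positivity),
      Real.log_mul hc.ne' (Real.exp_pos _).ne', Real.log_exp, Real.log_exp]
    have h1 : min (γ / 2) (-Real.log q / (N + 1)) * d ≤ γ / 2 * d :=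
      mul_le_mul_of_nonneg_right (min_le_left _ _) hd0
    rw [div_lt_iff₀ hγ] at hN
    nlinarith

lemma pexp_eq (f : ι → G) (μ : ℝ → Measure (Config (G × ι))) :
    pexp f μ = sSup {p | p ∈ Set.Icc (0 : ℝ) 1 ∧ ExpDecay f (μ p)} := rfl

lemma pexp_nonneg (f : ι → G) (μ : ℝ → Measure (Config (G × ι))) : 0 ≤ pexp f μ :=
  Real.sSup_nonneg fun _ hp => hp.1.1

lemma pexp_le_one (f : ι → G) (μ : ℝ → Measure (Config (G × ι))) : pexp f μ ≤ 1 :=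
  Real.sSup_le (fun _ hp => hp.1.2) zero_le_one

lemma le_pexp {f : ι → G} {μ : ℝ → Measure (Config (G × ι))} {p : ℝ}
    (hp : p ∈ Set.Icc (0 : ℝ) 1) (h : ExpDecay f (μ p)) : p ≤ pexp f μ :=
  le_csSup ⟨1, fun _ hq => hq.1.2⟩ ⟨hp, h⟩

/-- Exponential decay holds strictly below `pexp`. -/
lemma expDecay_of_lt_pexp [Countable G] [Countable ι] {f : ι → G}
    {μ : ℝ → Measure (Config (G × ι))} (hμ : ∀ p ∈ Set.Icc (0 : ℝ) 1, IsBernoulli p (μ p)) {p : ℝ}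
    (hp0 : 0 ≤ p) (hp : p < pexp f μ) : ExpDecay f (μ p) := by
  rw [pexp_eq] at hp
  have hne : {p | p ∈ Set.Icc (0 : ℝ) 1 ∧ ExpDecay f (μ p)}.Nonempty := by
    by_contra hne
    rw [Set.not_nonempty_iff_eq_empty.1 hne, Real.sSup_empty] at hp
    linarith
  obtain ⟨q, ⟨hq, c, hc, γ, hγ, hd⟩, hpq⟩ := exists_lt_of_lt_csSup hne hp
  refine ⟨c, hc, γ, hγ, fun x y => le_trans ?_ (hd x y)⟩
  have := (hμ q hq).isProbabilityMeasure
  exact ENNReal.toReal_mono (measure_ne_top _ _) <|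
    IsBernoulli.measure_mono ⟨hp0, hpq.le.trans hq.2⟩ hq hpq.le
      (hμ p ⟨hp0, hpq.le.trans hq.2⟩) (hμ q hq) (measurableSet_conn f x y)
      fun _ _ h => Conn.mono h

end Cayley

end Perc

namespace Perc

open Monoid CoprodI

section Syllables

variable {ι : Type*} {G : ι → Type*} [∀ i, Group (G i)]

/-- The product in the free product of a list of syllables. -/
def listProd (l : List (Σ i, G i)) : CoprodI G := (l.map fun a => of a.2).prod

@[simp] lemma listProd_nil : listProd ([] : List (Σ i, G i)) = 1 := rfl

@[simp] lemma listProd_cons (a : Σ i, G i) (l : List (Σ i, G i)) :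
    listProd (a :: l) = of a.2 * listProd l := by simp [listProd]

@[simp] lemma listProd_append (l l' : List (Σ i, G i)) :
    listProd (l ++ l') = listProd l * listProd l' := by simp [listProd]

/-- A list of nontrivial syllables, adjacent ones lying in different factors. -/
def Reduced (l : List (Σ i, G i)) : Prop :=
  (∀ a ∈ l, a.2 ≠ 1) ∧ l.IsChain fun a b => a.1 ≠ b.1

lemma Reduced.left {l l' : List (Σ i, G i)} (h : Reduced (l ++ l')) : Reduced l :=
  ⟨fun a ha => h.1 a (List.mem_append_left _ ha), (List.isChain_append.1 h.2).1⟩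

lemma Reduced.right {l l' : List (Σ i, G i)} (h : Reduced (l ++ l')) : Reduced l' :=
  ⟨fun a ha => h.1 a (List.mem_append_right _ ha), (List.isChain_append.1 h.2).2.1⟩

/-- The syllables of the inverse. -/
def listInv (l : List (Σ i, G i)) : List (Σ i, G i) :=
  (l.map fun a => (⟨a.1, a.2⁻¹⟩ : Σ i, G i)).reverse

lemma listProd_listInv (l : List (Σ i, G i)) : listProd (listInv l) = (listProd l)⁻¹ := by
  induction l with
  | nil => simp [listInv]
  | cons a l ih =>
    have : listInv (a :: l) = listInv l ++ [⟨a.1, a.2⁻¹⟩] := by simp [listInv]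
    simp [this, ih]

lemma Reduced.listInv {l : List (Σ i, G i)} (h : Reduced l) : Reduced (listInv l) := by
  refine ⟨fun a ha => ?_, ?_⟩
  · simp only [Perc.listInv, List.mem_reverse, List.mem_map] at ha
    obtain ⟨b, hb, rfl⟩ := ha
    simpa using h.1 b hb
  · rw [Perc.listInv, List.isChain_reverse, List.isChain_map]
    exact h.2.imp fun _ _ => Ne.symm

lemma reduced_singleton {i : ι} {g : G i} (hg : g ≠ 1) :
    Reduced ([⟨i, g⟩] : List (Σ i, G i)) := ⟨by simpa using hg, by simp⟩

variable [DecidableEq ι]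

/-- The last syllable of a list if it lies in the factor `i`, and `1` otherwise. -/
def lastOf (i : ι) (l : List (Σ i, G i)) : G i :=
  match l.getLast? with
  | none => 1
  | some a => if h : a.1 = i then h ▸ a.2 else 1

lemma lastOf_cons (i : ι) (a : Σ i, G i) {l : List (Σ i, G i)} (hl : l ≠ []) :
    lastOf i (a :: l) = lastOf i l := by
  obtain ⟨b, l, rfl⟩ := List.exists_cons_of_ne_nil hl
  simp [lastOf, List.getLast?_cons_cons]

lemma lastOf_append_singleton (i : ι) (g : G i) (l : List (Σ i, G i)) :
    lastOf i (l ++ [⟨i, g⟩]) = g := by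
  simp [lastOf]

lemma lastOf_singleton_of_ne {i k : ι} (h : k ≠ i) (g : G k) :
    lastOf i ([⟨k, g⟩] : List (Σ i, G i)) = 1 := by
  simp [lastOf, h]

lemma Reduced.lastOf_eq_one {i : ι} {h : G i} {l l' : List (Σ i, G i)}
    (hl : Reduced (l ++ ⟨i, h⟩ :: l')) : lastOf i l = 1 := by
  have := (List.isChain_append.1 hl.2).2.2
  unfold lastOf
  split
  · rfl
  · next a ha => rw [dif_neg (this a ha ⟨i, h⟩ rfl)]

variable [∀ i, DecidableEq (G i)]

/-- The last syllable of the normal form of `x` if it lies in the factor `i`, and `1`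
otherwise. -/
def lastSyl (i : ι) (x : CoprodI G) : G i := lastOf i (Word.equiv x).toList

lemma Reduced.lastSyl_listProd {l : List (Σ i, G i)} (hl : Reduced l) (i : ι) :
    lastSyl i (listProd l) = lastOf i l :=
  congrArg (fun w : Word G => lastOf i w.toList) (Word.equiv.right_inv ⟨l, hl.1, hl.2⟩)

lemma lastSyl_one (i : ι) : lastSyl i (1 : CoprodI G) = 1 :=
  Reduced.lastSyl_listProd (l := []) ⟨by simp, by simp⟩ i

@[simp] lemma lastSyl_of {i : ι} (g : G i) : lastSyl i (of g) = g := by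
  rcases eq_or_ne g 1 with rfl | hg
  · rw [map_one, lastSyl_one]
  · have := (reduced_singleton hg).lastSyl_listProd i
    rwa [← List.nil_append [_], lastOf_append_singleton, List.nil_append, listProd_cons, listProd_nil, mul_one] at this

lemma lastSyl_of_ne {i k : ι} (h : k ≠ i) (g : G k) : lastSyl i (of g) = 1 := by
  rcases eq_or_ne g 1 with rfl | hg
  · rw [map_one, lastSyl_one]
  · simpa [lastOf_singleton_of_ne h] using (reduced_singleton hg).lastSyl_listProd i

lemma lastOf_rcons (i : ι) {k : ι} (p : Word.Pair G k) (hp : p.tail.toList ≠ []) :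
    lastOf i (Word.rcons p).toList = lastOf i p.tail.toList := by
  unfold Word.rcons
  split
  · rfl
  · exact lastOf_cons i _ hp

/-- Left multiplication by a syllable changes the last syllable in the factor `i` only for
elements of that factor. -/
lemma lastSyl_of_mul (i : ι) {k : ι} (m : G k) (x : CoprodI G) :
    lastSyl i (of m * x) = lastSyl i x ∨ k = i ∧ ∃ g : G k, x = of g := by
  set p := Word.equivPair k (Word.equiv x) with hp
  have hx : Word.equiv x = Word.rcons p := ((Word.equivPair k).symm_apply_apply _).symm
  by_cases ht : p.tail.toList = []
  · have hxp : x = of p.head := by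
      have h1 : x = (Word.equiv x).prod := (Word.equiv.left_inv x).symm
      rw [h1, hx, Word.prod_rcons, Word.prod, ht]
      simp
    rcases eq_or_ne k i with rfl | hki
    · exact Or.inr ⟨rfl, _, hxp⟩
    · left
      rw [hxp, ← map_mul, lastSyl_of_ne hki, lastSyl_of_ne hki]
  · left
    have hmx : Word.equiv (of m * x) = Word.rcons { p with head := m * p.head } :=
      (mul_smul (of m) x Word.empty).trans (Word.of_smul_def k _ m)
    unfold lastSyl
    rw [hmx, hx, lastOf_rcons i p ht]
    exact lastOf_rcons i _ ht

lemma Reduced.lastSyl_inv {i : ι} {h : G i} {l : List (Σ i, G i)} (hl : Reduced (⟨i, h⟩ :: l)) :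
    lastSyl i (listProd (⟨i, h⟩ :: l))⁻¹ = h⁻¹ := by
  rw [← listProd_listInv, hl.listInv.lastSyl_listProd]
  simpa [Perc.listInv] using lastOf_append_singleton i h⁻¹ (Perc.listInv l)

lemma Reduced.listProd_ne_of {i : ι} {h h' : G i} {l l' : List (Σ i, G i)}
    (hl : Reduced (⟨i, h⟩ :: (l ++ ⟨i, h'⟩ :: l'))) (g : G i) :
    listProd (⟨i, h⟩ :: l) ≠ of g := by
  intro he
  have hl' : Reduced ((⟨i, h⟩ :: l) ++ ⟨i, h'⟩ :: l') := hl
  have h1 : g = 1 := by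
    rw [← lastSyl_of g, ← he, hl'.left.lastSyl_listProd, hl'.lastOf_eq_one]
  have h2 := hl'.left.lastSyl_inv
  rw [he, h1, map_one, inv_one, lastSyl_one] at h2
  exact hl.1 _ List.mem_cons_self (inv_eq_one.1 h2.symm)

end Syllables

end Perc

namespace Perc

open Monoid CoprodI

section FreeProduct

variable {n : ℕ} {G : Fin n → Type*} [∀ i, Group (G i)] (S : ∀ i, Set (G i))

/-- The copy in the free product, translated by `w`, of the edges of the `i`-th factor. -/
def cosetEdge (w : CoprodI G) (i : Fin n) (e : G i × S i) : CoprodI G × (Σ i, S i) :=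
  (w * of e.1, ⟨i, e.2⟩)

lemma cosetEdge_injective (w : CoprodI G) (i : Fin n) :
    Function.Injective (cosetEdge S w i) := by
  rintro ⟨g, s⟩ ⟨g', s'⟩ h
  simp only [cosetEdge, Prod.mk.injEq, mul_right_inj, Sigma.mk.injEq, heq_eq_eq, true_and] at h
  exact Prod.ext (of_injective i h.1) h.2

/-- The configuration seen in a coset of the `i`-th factor. -/
def cosetConfig (w : CoprodI G) (i : Fin n) (ω : Config (CoprodI G × (Σ i, S i))) :
    Config (G i × S i) := fun e => ω (cosetEdge S w i e)

lemma conn_of_cosetConfig {w : CoprodI G} {i : Fin n} {ω : Config (CoprodI G × (Σ i, S i))}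
    {x y : G i} (h : Conn (setGens (S i)) (cosetConfig S w i ω) x y) :
    Conn (coprodIGens S) ω (w * of x) (w * of y) := by
  refine Relation.ReflTransGen.lift (fun g => w * of g) ?_ _ _ h
  rintro a b ⟨s, ⟨ho, rfl⟩ | ⟨ho, rfl⟩⟩
  · exact ⟨⟨i, s⟩, Or.inl ⟨ho, by simp [coprodIGens, setGens, mul_assoc]⟩⟩
  · exact ⟨⟨i, s⟩, Or.inr ⟨ho, by simp [coprodIGens, setGens, mul_assoc]⟩⟩

lemma coprodIGens_generates {S : ∀ i, Set (G i)} (hS : ∀ i, Generates (setGens (S i))) :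
    Generates (coprodIGens S) := by
  intro x
  induction x using CoprodI.induction_on with
  | one => exact ⟨[], by simp [IsGenWord], rfl⟩
  | of i g =>
    obtain ⟨l, hl, rfl⟩ := hS i g
    obtain ⟨l', hl', hp, -⟩ := hl.exists_map (f' := coprodIGens S) (of : G i →* CoprodI G)
      fun s => Or.inr ⟨⟨i, s⟩, rfl⟩
    exact ⟨l', hl', hp⟩
  | mul x y hx hy =>
    obtain ⟨l, hl, rfl⟩ := hx
    obtain ⟨l', hl', rfl⟩ := hy
    exact ⟨l ++ l', hl.append hl', by simp⟩

lemma wdist_of_le {S : ∀ i, Set (G i)} (hS : ∀ i, Generates (setGens (S i))) {i : Fin n}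
    (x y : G i) : wdist (coprodIGens S) (of x) (of y) ≤ wdist (setGens (S i)) x y :=
  (hS i).wdist_map_le of (fun s => Or.inr ⟨⟨i, s⟩, rfl⟩) x y

lemma le_wdist_of {S : ∀ i, Set (G i)} (hS : ∀ i, Generates (setGens (S i))) {i : Fin n}
    (x y : G i) : wdist (setGens (S i)) x y ≤ wdist (coprodIGens S) (of x) (of y) := by
  have h := (coprodIGens_generates hS).wdist_map_le (f' := setGens (S i))
    (lift (Pi.mulSingle i (MonoidHom.id (G i)))) (fun ⟨k, s⟩ => ?_) (of x) (of y)
  · rwa [of_leftInverse, of_leftInverse] at h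
  · rw [coprodIGens, lift_of]
    rcases eq_or_ne k i with rfl | hk
    · exact Or.inr ⟨s, by simp [setGens]⟩
    · exact Or.inl (by simp [Pi.mulSingle_eq_of_ne hk])

lemma ExpDecay.factor {S : ∀ i, Set (G i)} (hfin : ∀ i, (S i).Finite)
    (hS : ∀ i, Generates (setGens (S i))) {p : ℝ} (hp : p ∈ Set.Icc (0 : ℝ) 1) {i : Fin n}
    {μ : Measure (Config (CoprodI G × (Σ i, S i)))} {ν : Measure (Config (G i × S i))}
    (hμ : IsBernoulli p μ) (hν : IsBernoulli p ν) (h : ExpDecay (coprodIGens S) μ) :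
    ExpDecay (setGens (S i)) ν := by
  have := hμ.isProbabilityMeasure
  have := (hfin i).to_subtype
  have := (hS i).countable
  obtain ⟨c, hc, γ, hγ, hd⟩ := h
  refine ⟨c, hc, γ, hγ, fun x y => ?_⟩
  rw [← hμ.map_comp hp hν (cosetEdge_injective S 1 i),
    Measure.map_apply (by fun_prop) (measurableSet_conn _ x y)]
  refine (ENNReal.toReal_mono (measure_ne_top _ _) (measure_mono fun ω hω => ?_)).trans
    ((hd (of x) (of y)).trans ?_)
  · simpa using conn_of_cosetConfig S (w := 1) hω
  · have : (wdist (setGens (S i)) x y : ℝ) ≤ wdist (coprodIGens S) (of x) (of y) := by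
      exact_mod_cast le_wdist_of hS x y
    gcongr ?_ * Real.exp ?_
    nlinarith

/-- The edges of all the cosets traversed by the geodesic from `b` to `b * listProd l`. -/
def pathEdges : List (Σ i, G i) → CoprodI G → Set (CoprodI G × (Σ i, S i))
  | [], _ => ∅
  | a :: l, b => Set.range (cosetEdge S b a.1) ∪ pathEdges l (b * of a.2)

lemma exists_of_mem_pathEdges {l : List (Σ i, G i)} {b : CoprodI G}
    {e : CoprodI G × (Σ i, S i)} (he : e ∈ pathEdges S l b) :
    ∃ l₁ a l₂, l = l₁ ++ a :: l₂ ∧ e ∈ Set.range (cosetEdge S (b * listProd l₁) a.1) := by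
  induction l generalizing b with
  | nil => exact he.elim
  | cons a l ih =>
    rcases he with he | he
    · exact ⟨[], a, l, rfl, by simpa using he⟩
    · obtain ⟨l₁, a', l₂, rfl, h⟩ := ih he
      exact ⟨a :: l₁, a', l₂, rfl, by simpa [mul_assoc] using h⟩

lemma disjoint_pathEdges [∀ i, DecidableEq (G i)] {a : Σ i, G i} {l : List (Σ i, G i)}
    (hl : Reduced (a :: l)) (b : CoprodI G) :
    Disjoint (Set.range (cosetEdge S b a.1)) (pathEdges S l (b * of a.2)) := by
  rw [Set.disjoint_left]
  rintro _ ⟨⟨g, s⟩, rfl⟩ he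
  obtain ⟨l₁, ⟨k, h⟩, l₂, rfl, ⟨g', s'⟩, heq⟩ := exists_of_mem_pathEdges S he
  obtain ⟨i, m⟩ := a
  simp only [cosetEdge, Prod.mk.injEq, Sigma.mk.injEq] at heq
  obtain ⟨h1, rfl, -⟩ := heq
  refine hl.listProd_ne_of (g * g'⁻¹) ?_
  rw [map_mul, map_inv, eq_mul_inv_iff_mul_eq, listProd_cons]
  simpa [mul_assoc] using h1

/-- The event that in each of the cosets traversed by the geodesic from `b` to
`b * listProd l`, the entrance and exit points are connected within the coset. -/
def pathEvent : List (Σ i, G i) → CoprodI G → Set (Config (CoprodI G × (Σ i, S i)))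
  | [], _ => Set.univ
  | a :: l, b => cosetConfig S b a.1 ⁻¹' {ω | Conn (setGens (S a.1)) ω 1 a.2} ∩
      pathEvent l (b * of a.2)

lemma measurableSet_pathEvent {S : ∀ i, Set (G i)} (hfin : ∀ i, (S i).Finite)
    (hS : ∀ i, Generates (setGens (S i))) (l : List (Σ i, G i)) (b : CoprodI G) :
    MeasurableSet[edgeSigma (pathEdges S l b)] (pathEvent S l b) := by
  induction l generalizing b with
  | nil => exact @MeasurableSet.univ _ (edgeSigma _)
  | cons a l ih =>
    have := (hfin a.1).to_subtype
    have := (hS a.1).countable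
    refine @MeasurableSet.inter _ (edgeSigma _) _ _ ?_ ?_
    · exact measurableSet_edgeSigma_preimage (cosetEdge S b a.1)
        (fun e => Set.mem_union_left _ (Set.mem_range_self e)) (measurableSet_conn _ _ _)
    · exact edgeSigma_mono Set.subset_union_right _ (ih _)

lemma measure_pathEvent_le [∀ i, DecidableEq (G i)] {S : ∀ i, Set (G i)}
    (hfin : ∀ i, (S i).Finite) (hS : ∀ i, Generates (setGens (S i))) {p : ℝ}
    (hp : p ∈ Set.Icc (0 : ℝ) 1) {μ : Measure (Config (CoprodI G × (Σ i, S i)))}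
    {ν : ∀ i, Measure (Config (G i × S i))} (hμ : IsBernoulli p μ) (hν : ∀ i, IsBernoulli p (ν i))
    {γ : ℝ} (hγ : 0 ≤ γ) (hd : ∀ i, ∀ g : G i, (ν i {ω | Conn (setGens (S i)) ω 1 g}).toReal ≤
      Real.exp (-γ * (wdist (setGens (S i)) 1 g : ℝ)))
    {l : List (Σ i, G i)} (hl : Reduced l) (b : CoprodI G) :
    (μ (pathEvent S l b)).toReal ≤
      Real.exp (-γ * (wdist (coprodIGens S) 1 (listProd l) : ℝ)) := by
  have := hμ.isProbabilityMeasure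
  induction l generalizing b with
  | nil => simpa [wdist_self] using ENNReal.toReal_mono ENNReal.one_ne_top (prob_le_one (μ := μ))
  | cons a l ih =>
    have := (hfin a.1).to_subtype
    have := (hS a.1).countable
    have hmeas := measurableSet_conn (setGens (S a.1)) 1 a.2
    have hA : MeasurableSet[edgeSigma (Set.range (cosetEdge S b a.1))]
        (cosetConfig S b a.1 ⁻¹' {ω | Conn (setGens (S a.1)) ω 1 a.2}) :=
      measurableSet_edgeSigma_preimage (cosetEdge S b a.1) Set.mem_range_self hmeas
    have hmul := hμ.measure_inter hp (disjoint_pathEdges S hl b) hA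
      (measurableSet_pathEvent hfin hS l _)
    have hfirst : μ (cosetConfig S b a.1 ⁻¹' {ω | Conn (setGens (S a.1)) ω 1 a.2}) =
        ν a.1 {ω | Conn (setGens (S a.1)) ω 1 a.2} := by
      rw [← hμ.map_comp hp (hν a.1) (cosetEdge_injective S b a.1),
        Measure.map_apply (by fun_prop) hmeas]
      rfl
    rw [pathEvent, hmul, hfirst, ENNReal.toReal_mul]
    refine (mul_le_mul (hd a.1 a.2) (ih (Reduced.right (l := [a]) hl) _) ENNReal.toReal_nonneg
      (Real.exp_pos _).le).trans ?_
    rw [← Real.exp_add, Real.exp_le_exp, ← mul_add]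
    have h1 : (wdist (coprodIGens S) 1 (listProd (a :: l)) : ℝ) ≤
        wdist (setGens (S a.1)) 1 a.2 + wdist (coprodIGens S) 1 (listProd l) := by
      have h2 := (coprodIGens_generates hS).wdist_triangle 1 (of a.2) (listProd (a :: l))
      have h3 := wdist_of_le hS 1 a.2
      have h4 := wdist_mul_left (coprodIGens S) (of a.2) 1 (listProd l)
      rw [map_one] at h3
      rw [mul_one, ← listProd_cons] at h4
      exact_mod_cast (by omega)
    nlinarith

variable [∀ i, DecidableEq (G i)]

/-- The nearest-point projection to the coset `w * of (G i)`, in the coordinate of `G i`. -/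
def cosetProj (w : CoprodI G) (i : Fin n) (x : CoprodI G) : G i := (lastSyl i (x⁻¹ * w))⁻¹

lemma cosetProj_edge (w : CoprodI G) (i : Fin n) {ω : Config (CoprodI G × (Σ i, S i))}
    {a : CoprodI G} {s : Σ i, S i} (h : ω (a, s) = true) :
    cosetProj w i (a * coprodIGens S s) = cosetProj w i a ∨
      ∃ t : S i, cosetConfig S w i ω (cosetProj w i a, t) = true ∧
        cosetProj w i (a * coprodIGens S s) = cosetProj w i a * setGens (S i) t := by
  obtain ⟨k, s⟩ := s
  have hmul : (a * coprodIGens S ⟨k, s⟩)⁻¹ * w = of (s : G k)⁻¹ * (a⁻¹ * w) := by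
    simp [coprodIGens, mul_assoc]
  rcases lastSyl_of_mul i (s : G k)⁻¹ (a⁻¹ * w) with h1 | ⟨rfl, g, hg⟩
  · left
    rw [cosetProj, hmul, h1, cosetProj]
  · right
    refine ⟨s, ?_, ?_⟩
    · have ha : w * of g⁻¹ = a := by rw [map_inv, ← hg]; group
      rw [cosetConfig, cosetEdge, cosetProj, hg, lastSyl_of, ha, h]
    · rw [cosetProj, hmul, cosetProj, hg, ← map_mul, lastSyl_of, lastSyl_of]
      simp [setGens]

lemma conn_cosetProj (w : CoprodI G) (i : Fin n) {ω : Config (CoprodI G × (Σ i, S i))}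
    {x y : CoprodI G} (h : Conn (coprodIGens S) ω x y) :
    Conn (setGens (S i)) (cosetConfig S w i ω) (cosetProj w i x) (cosetProj w i y) := by
  induction h with
  | refl => exact .refl
  | tail _ hs ih =>
    obtain ⟨s, ⟨ho, rfl⟩ | ⟨ho, rfl⟩⟩ := hs
    · rcases cosetProj_edge S w i ho with he | ⟨t, ht, he⟩
      · rwa [he]
      · exact ih.tail ⟨t, Or.inl ⟨ht, he⟩⟩
    · rcases cosetProj_edge S w i ho with he | ⟨t, ht, he⟩
      · rwa [he] at ih
      · exact ih.tail ⟨t, Or.inr ⟨ht, he⟩⟩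

lemma mem_pathEvent_of_conn {ω : Config (CoprodI G × (Σ i, S i))} {x : CoprodI G}
    {l₁ l₂ : List (Σ i, G i)} (hl : Reduced (l₁ ++ l₂))
    (h : Conn (coprodIGens S) ω x (x * listProd (l₁ ++ l₂))) :
    ω ∈ pathEvent S l₂ (x * listProd l₁) := by
  induction l₂ generalizing l₁ with
  | nil => trivial
  | cons a l ih =>
    obtain ⟨i, m⟩ := a
    refine ⟨?_, ?_⟩
    · have hc := conn_cosetProj S (x * listProd l₁) i h
      have h1 : cosetProj (x * listProd l₁) i x = 1 := by
        rw [cosetProj, inv_mul_cancel_left, hl.left.lastSyl_listProd, hl.lastOf_eq_one, inv_one]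
      have h2 : cosetProj (x * listProd l₁) i (x * listProd (l₁ ++ ⟨i, m⟩ :: l)) = m := by
        have : (x * listProd (l₁ ++ ⟨i, m⟩ :: l))⁻¹ * (x * listProd l₁) =
            (listProd (⟨i, m⟩ :: l))⁻¹ := by
          rw [listProd_append]; group
        rw [cosetProj, this, hl.right.lastSyl_inv, inv_inv]
      rwa [h1, h2] at hc
    · have := ih (l₁ := l₁ ++ [⟨i, m⟩]) (by simpa using hl) (by simpa using h)
      simpa [mul_assoc] using this

lemma expDecay_freeProduct {S : ∀ i, Set (G i)} (hn : 0 < n) (hfin : ∀ i, (S i).Finite)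
    (hS : ∀ i, Generates (setGens (S i))) {p : ℝ} (hp0 : 0 ≤ p) (hp1 : p < 1)
    {μ : Measure (Config (CoprodI G × (Σ i, S i)))} {ν : ∀ i, Measure (Config (G i × S i))}
    (hμ : IsBernoulli p μ) (hν : ∀ i, IsBernoulli p (ν i))
    (h : ∀ i, ExpDecay (setGens (S i)) (ν i)) : ExpDecay (coprodIGens S) μ := by
  have := hμ.isProbabilityMeasure
  have hrate : ∀ i, ∃ γ > 0, ∀ g : G i, (ν i {ω | Conn (setGens (S i)) ω 1 g}).toReal ≤
      Real.exp (-γ * (wdist (setGens (S i)) 1 g : ℝ)) := fun i => by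
    have := (hfin i).to_subtype
    have := (hS i).countable
    exact (h i).exists_rate hp1 (hν i)
  choose γ hγ hd using hrate
  have : Nonempty (Fin n) := ⟨⟨0, hn⟩⟩
  obtain ⟨i₀, hi₀⟩ := Finite.exists_min γ
  refine ⟨1, one_pos, γ i₀, hγ i₀, fun x y => ?_⟩
  have hd' : ∀ i, ∀ g : G i, (ν i {ω | Conn (setGens (S i)) ω 1 g}).toReal ≤
      Real.exp (-γ i₀ * (wdist (setGens (S i)) 1 g : ℝ)) := fun i g => by
    refine (hd i g).trans (Real.exp_le_exp.2 ?_)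
    exact mul_le_mul_of_nonneg_right (neg_le_neg (hi₀ i)) (Nat.cast_nonneg _)
  set w := Word.equiv (x⁻¹ * y)
  have hw : listProd w.toList = x⁻¹ * y := Word.equiv.left_inv (x⁻¹ * y)
  have hred : Reduced w.toList := ⟨w.ne_one, w.chain_ne⟩
  have hxy : x * listProd w.toList = y := by rw [hw]; group
  have hdist : wdist (coprodIGens S) x y = wdist (coprodIGens S) 1 (listProd w.toList) := by
    rw [← wdist_mul_left _ x 1, mul_one, hxy]
  rw [one_mul, hdist]
  refine le_trans (ENNReal.toReal_mono (measure_ne_top _ _) (measure_mono fun ω hω => ?_))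
    (measure_pathEvent_le hfin hS ⟨hp0, hp1.le⟩ hμ hν (hγ i₀).le hd' hred x)
  have hω' : Conn (coprodIGens S) ω x y := hω
  simpa using mem_pathEvent_of_conn S (l₁ := []) hred (by simpa [hxy] using hω')

end FreeProduct

end Perc

open Perc

/-- For `n ≥ 2` nontrivial finitely generated groups `Gᵢ` with finite
generating sets `Sᵢ`, Schonmann's critical point of the Cayley graph of the free product
`G₁ * ⋯ * G_n` w.r.t. `S₁ ⊔ ⋯ ⊔ S_n` is the minimum of the critical points of the
factors:  `p_exp(G₁ * ⋯ * G_n) = min_i p_exp(Gᵢ)`. -/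
theorem pexp_free_product
    {n : ℕ} (hn : 2 ≤ n) {G : Fin n → Type*} [∀ i, Group (G i)] [∀ i, Nontrivial (G i)]
    (S : ∀ i, Set (G i)) (hfin : ∀ i, (S i).Finite)
    (hgen : ∀ i, Subgroup.closure (S i) = ⊤)
    (μi : ∀ i, ℝ → Measure (Config (G i × S i)))
    (μ : ℝ → Measure (Config (Monoid.CoprodI G × (Σ i, S i))))
    (hμi : ∀ i, ∀ p ∈ Set.Icc (0 : ℝ) 1, IsBernoulli p (μi i p))
    (hμ : ∀ p ∈ Set.Icc (0 : ℝ) 1, IsBernoulli p (μ p)) :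
    pexp (coprodIGens S) μ = ⨅ i : Fin n, pexp (setGens (S i)) (μi i) := by
  classical
  have hS : ∀ i, Generates (setGens (S i)) := fun i => generates_setGens (hgen i)
  have hn0 : 0 < n := by omega
  have : Nonempty (Fin n) := ⟨⟨0, hn0⟩⟩
  have := fun i => (hfin i).to_subtype
  have := fun i => (hS i).countable
  refine le_antisymm (le_ciInf fun i => ?_) (le_of_forall_lt fun p hp => ?_)
  · exact Real.sSup_le (fun p hp =>
      le_pexp hp.1 (ExpDecay.factor hfin hS hp.1 (hμ p hp.1) (hμi i p hp.1) hp.2))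
      (pexp_nonneg _ _)
  · obtain ⟨q, hpq, hq⟩ := exists_between hp
    refine hpq.trans_le ?_
    rcases lt_or_ge q 0 with hq0 | hq0
    · exact hq0.le.trans (pexp_nonneg _ _)
    have hqi : ∀ i, q < pexp (setGens (S i)) (μi i) := fun i =>
      hq.trans_le (ciInf_le (Set.finite_range _).bddBelow i)
    have hq1 : q < 1 := (hqi ⟨0, hn0⟩).trans_le (pexp_le_one _ _)
    have hqI : q ∈ Set.Icc (0 : ℝ) 1 := ⟨hq0, hq1.le⟩
    exact le_pexp hqI (expDecay_freeProduct hn0 hfin hS hq0 hq1 (hμ q hqI)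
      (fun i => hμi i q hqI) fun i => expDecay_of_lt_pexp (hμi i) hq0 (hqi i))
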